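/- arXiv:2501.05672 — 2 statements merged into one kernel-verified Lean document; each statement's English description precedes it below -/
import Mathlib

section
/- Define Ī(x, s) = x − (x − (s + ā)⁺)⁺. Then π(Ī) = ā, the seller never defaults under Ī (i.e., Ī(X,S) ≤ (S + ā)⁺ a.s.), and for every a ∈ [ā, π_f] and every I ∈ 𝓐 with π(I) = a, one has 𝔼[u(W(Ī))] − 𝔼[u(W(I))] ≥ u′(w − ā) · (η/(1+η)) · (a − ā) ≥ 0. -/
open MeasureTheory Set

noncomputable section

variable {Ω : Type*} [MeasurableSpace Ω]

/-- Expected-value premium of an indemnity `I = I(x, s)`. -/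
def premium (ℙ : Measure Ω) (η : ℝ) (X S : Ω → ℝ) (I : ℝ → ℝ → ℝ) : ℝ :=
  (1 + η) * ∫ ω, I (X ω) (S ω) ∂ℙ

/-- Buyer's terminal wealth under endogenous default with recovery ratio `τ`:
`W(I) = w − X − π(I) + 𝕀(I)` where `𝕀(I) = I·1_{I ≤ R} + τ·R·1_{I > R}` and
`R = (S + π(I))⁺`. -/
def wealth (ℙ : Measure Ω) (η τ w : ℝ) (X S : Ω → ℝ) (I : ℝ → ℝ → ℝ) (ω : Ω) : ℝ :=
  w - X ω - premium ℙ η X S I +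
    (if I (X ω) (S ω) ≤ max (S ω + premium ℙ η X S I) 0 then I (X ω) (S ω)
     else τ * max (S ω + premium ℙ η X S I) 0)

/-- Buyer's expected utility `𝔼[u(W(I))]`. -/
def EU (ℙ : Measure Ω) (η τ w : ℝ) (X S : Ω → ℝ) (u : ℝ → ℝ) (I : ℝ → ℝ → ℝ) : ℝ :=
  ∫ ω, u (wealth ℙ η τ w X S I ω) ∂ℙ

/-- Admissible indemnities `𝓐`: measurable and `0 ≤ I(x,s) ≤ x` on `[0, M] × ℝ`. -/
def Adm (M : ℝ) (I : ℝ → ℝ → ℝ) : Prop :=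
  Measurable (fun p : ℝ × ℝ => I p.1 p.2) ∧
    ∀ x ∈ Icc (0 : ℝ) M, ∀ s : ℝ, 0 ≤ I x s ∧ I x s ≤ x

/-- Full-insurance premium `π_f = (1+η)𝔼[X]`. -/
def piFull (ℙ : Measure Ω) (η : ℝ) (X : Ω → ℝ) : ℝ := (1 + η) * ∫ ω, X ω ∂ℙ

/-- `g(a) = (1+η)·𝔼[X − (X − (S+a)⁺)⁺] − a`. -/
def gfun (ℙ : Measure Ω) (η : ℝ) (X S : Ω → ℝ) (a : ℝ) : ℝ :=
  (1 + η) * ∫ ω, (X ω - max (X ω - max (S ω + a) 0) 0) ∂ℙ - a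

/-- `ā = inf {a ∈ [0, π_f] : g(a) ≤ 0}`. -/
def abar (ℙ : Measure Ω) (η : ℝ) (X S : Ω → ℝ) : ℝ :=
  sInf {a | a ∈ Icc 0 (piFull ℙ η X) ∧ gfun ℙ η X S a ≤ 0}

/-- The contract `Ī(x,s) = x − (x − (s + ā)⁺)⁺`. -/
def Ibar (ℙ : Measure Ω) (η : ℝ) (X S : Ω → ℝ) : ℝ → ℝ → ℝ :=
  fun x s => x - max (x - max (s + abar ℙ η X S) 0) 0

/-- The gradient inequality for a function with antitone derivative. -/
theorem sub_le_deriv_mul_sub_of_antitone {u u' : ℝ → ℝ} (hu : ∀ x, HasDerivAt u (u' x) x)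
    (hanti : Antitone u') (x y : ℝ) : u y - u x ≤ u' x * (y - x) := by
  rcases lt_trichotomy x y with h | rfl | h
  · obtain ⟨c, hc, hcs⟩ := exists_hasDerivAt_eq_slope u u' h
      (fun z _ => (hu z).continuousAt.continuousWithinAt) (fun z _ => hu z)
    rw [eq_div_iff (sub_pos.2 h).ne'] at hcs
    nlinarith [hanti hc.1.le, sub_pos.2 h]
  · simp
  · obtain ⟨c, hc, hcs⟩ := exists_hasDerivAt_eq_slope u u' h
      (fun z _ => (hu z).continuousAt.continuousWithinAt) (fun z _ => hu z)
    rw [eq_div_iff (sub_pos.2 h).ne'] at hcs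
    nlinarith [hanti hc.2.le, sub_pos.2 h]

/-- Composition of a continuous monotone function with an almost surely bounded random variable
is integrable. -/
theorem integrable_monotone_comp_of_ae_mem_Icc {ℙ : Measure Ω} [IsFiniteMeasure ℙ] {u : ℝ → ℝ}
    (hc : Continuous u) (hmono : Monotone u) {Y : Ω → ℝ} (hY : Measurable Y) {l r : ℝ}
    (hb : ∀ᵐ ω ∂ℙ, Y ω ∈ Icc l r) : Integrable (fun ω => u (Y ω)) ℙ :=
  Integrable.of_mem_Icc (u l) (u r) (hc.measurable.comp hY).aemeasurable
    (hb.mono fun _ h => ⟨hmono h.1, hmono h.2⟩)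

/-- A random variable with positive real essential supremum is almost surely bounded by it
(the essential supremum of an unbounded variable is `0` by convention). -/
theorem ae_le_of_essSup_pos {ℙ : Measure Ω} {X : Ω → ℝ} (hpos : 0 < essSup X ℙ) :
    ∀ᵐ ω ∂ℙ, X ω ≤ essSup X ℙ := by
  refine ae_le_essSup ?_
  by_contra hub
  have hempty : {a : ℝ | ∀ᵐ ω ∂ℙ, X ω ≤ a} = ∅ :=
    eq_empty_of_forall_notMem fun a ha => hub ⟨a, by simpa using ha⟩
  have hzero : essSup X ℙ = 0 := by
    rw [essSup, Filter.limsup_eq, hempty, Real.sInf_empty]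
  exact hpos.ne' hzero

/-- The stop-loss retention keeps the indemnity equal to the minimum of loss and reserve. -/
theorem sub_max_sub_zero_eq_min (x r : ℝ) : x - max (x - r) 0 = min x r := by
  rcases le_total x r with h | h
  · rw [max_eq_right (by linarith), min_eq_left h, sub_zero]
  · rw [max_eq_left (by linarith), min_eq_right h]; ring

theorem continuous_gfun (ℙ : Measure Ω) (η : ℝ) {X S : Ω → ℝ} (hXm : Measurable X)
    (hSm : Measurable S) (hX0 : ∀ ω, 0 ≤ X ω) (hXi : Integrable X ℙ) :
    Continuous (gfun ℙ η X S) := by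
  unfold gfun
  refine (continuous_const.mul ?_).sub continuous_id
  refine continuous_of_dominated (bound := X) (fun a => ?_) (fun a => ?_) hXi ?_
  · exact Measurable.aestronglyMeasurable (by fun_prop)
  · refine Filter.Eventually.of_forall fun ω => ?_
    rw [sub_max_sub_zero_eq_min, Real.norm_of_nonneg (le_min (hX0 ω) (le_max_right _ _))]
    exact min_le_left _ _
  · exact Filter.Eventually.of_forall fun ω => by fun_prop

theorem gfun_zero_nonneg (ℙ : Measure Ω) {η : ℝ} (hη : 0 ≤ η) {X S : Ω → ℝ}
    (hX0 : ∀ ω, 0 ≤ X ω) : 0 ≤ gfun ℙ η X S 0 := by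
  unfold gfun
  rw [sub_zero]
  refine mul_nonneg (by linarith) (integral_nonneg fun ω => ?_)
  simp only [sub_max_sub_zero_eq_min]
  exact le_min (hX0 ω) (le_max_right _ _)

theorem gfun_piFull_nonpos (ℙ : Measure Ω) {η : ℝ} (hη : 0 ≤ η) {X S : Ω → ℝ}
    (hX0 : ∀ ω, 0 ≤ X ω) (hXi : Integrable X ℙ) : gfun ℙ η X S (piFull ℙ η X) ≤ 0 := by
  unfold gfun
  rw [sub_nonpos]
  refine mul_le_mul_of_nonneg_left (integral_mono_of_nonneg ?_ hXi ?_) (by linarith)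
  · refine Filter.Eventually.of_forall fun ω => ?_
    simp only [sub_max_sub_zero_eq_min]
    exact le_min (hX0 ω) (le_max_right _ _)
  · exact Filter.Eventually.of_forall fun ω => sub_le_self _ (le_max_right _ _)

/-- The infimum defining `ā` is attained at a zero of `g`. -/
theorem gfun_abar_eq_zero (ℙ : Measure Ω) {η : ℝ} (hη : 0 ≤ η) {X S : Ω → ℝ}
    (hXm : Measurable X) (hSm : Measurable S) (hX0 : ∀ ω, 0 ≤ X ω) (hXi : Integrable X ℙ) :
    gfun ℙ η X S (abar ℙ η X S) = 0 := by
  have hcont := continuous_gfun ℙ η hXm hSm hX0 hXi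
  let A : Set ℝ := {a | a ∈ Icc 0 (piFull ℙ η X) ∧ gfun ℙ η X S a ≤ 0}
  have hclosed : IsClosed A := isClosed_Icc.inter (isClosed_le hcont continuous_const)
  have hbdd : BddBelow A := ⟨0, fun a ha => ha.1.1⟩
  have hpi : 0 ≤ piFull ℙ η X := mul_nonneg (by linarith) (integral_nonneg hX0)
  have hmem : abar ℙ η X S ∈ A :=
    hclosed.csInf_mem ⟨_, ⟨hpi, le_rfl⟩, gfun_piFull_nonpos ℙ hη hX0 hXi⟩ hbdd
  obtain ⟨c, hc, hgc⟩ := intermediate_value_Icc' hmem.1.1 hcont.continuousOn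
    ⟨hmem.2, gfun_zero_nonneg ℙ hη hX0⟩
  have hle : abar ℙ η X S ≤ c := csInf_le hbdd ⟨⟨hc.1, hc.2.trans hmem.1.2⟩, hgc.le⟩
  rwa [le_antisymm hle hc.2]

/-- The actual payment never exceeds the promised indemnity nor the reserve. -/
theorem ite_payment_le {τ i r : ℝ} (hτ : τ ≤ 1) (hr : 0 ≤ r) :
    (if i ≤ r then i else τ * r) ≤ i ∧ (if i ≤ r then i else τ * r) ≤ r := by
  split_ifs with h
  · exact ⟨le_rfl, h⟩
  · have : τ * r ≤ r := by nlinarith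
    exact ⟨by linarith, this⟩

theorem ite_payment_nonneg {τ i r : ℝ} (hτ : 0 ≤ τ) (hr : 0 ≤ r) (hi : 0 ≤ i) :
    0 ≤ (if i ≤ r then i else τ * r) := by
  split_ifs
  · exact hi
  · positivity

/-- Statewise comparison of the default-free contract with an alternative of higher premium `a`
paying `q`. -/
theorem utility_gap_ge {u u' : ℝ → ℝ} (hu : ∀ x, HasDerivAt u (u' x) x) (hanti : Antitone u')
    (hpos : ∀ x, 0 < u' x) {w x s a b i q : ℝ} (hab : b ≤ a) (hqi : q ≤ i)
    (hqr : q ≤ max (s + a) 0) :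
    u' (w - b) * (a - b + min x (max (s + b) 0) - i)
      ≤ u (w - x - b + min x (max (s + b) 0)) - u (w - x - a + q) := by
  have htan := sub_le_deriv_mul_sub_of_antitone hu hanti
    (w - x - b + min x (max (s + b) 0)) (w - x - a + q)
  have hle : u' (w - b) * (a - b + min x (max (s + b) 0) - i)
      ≤ u' (w - b) * (a - b + min x (max (s + b) 0) - q) :=
    mul_le_mul_of_nonneg_left (by linarith) (hpos _).le
  rcases le_total x (max (s + b) 0) with h | h
  · rw [min_eq_left h] at *
    have hW : w - x - b + x = w - b := by ring
    rw [hW] at htan ⊢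
    nlinarith
  · rw [min_eq_right h] at *
    have hmarg : u' (w - b) ≤ u' (w - x - b + max (s + b) 0) := hanti (by linarith)
    have hres : max (s + a) 0 ≤ max (s + b) 0 + (a - b) :=
      max_le (by linarith [le_max_left (s + b) 0]) (by linarith [le_max_right (s + b) 0])
    nlinarith [mul_le_mul_of_nonneg_right hmarg
      (show 0 ≤ a - b + max (s + b) 0 - q by linarith)]

/-- `π(Ī) = ā`, the seller never defaults under `Ī`, and for every
`a ∈ [ā, π_f]` and every `I ∈ 𝓐` with `π(I) = a`,
`𝔼[u(W(Ī))] − 𝔼[u(W(I))] ≥ u′(w − ā)·(η/(1+η))·(a − ā) ≥ 0`. -/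
theorem stmt4
    (ℙ : Measure Ω) [IsProbabilityMeasure ℙ]
    (X S : Ω → ℝ) (hXm : Measurable X) (hSm : Measurable S)
    (hX0 : ∀ ω, 0 ≤ X ω) (M : ℝ) (hM : essSup X ℙ = M) (hM0 : 0 < M)
    (η : ℝ) (hη : 0 ≤ η) (τ : ℝ) (hτ : τ ∈ Icc (0 : ℝ) 1) (w : ℝ)
    (u u' u'' : ℝ → ℝ)
    (hu' : ∀ x, HasDerivAt u (u' x) x) (hu'' : ∀ x, HasDerivAt u' (u'' x) x)
    (hu'pos : ∀ x, 0 < u' x) (hu''neg : ∀ x, u'' x < 0) :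
    premium ℙ η X S (Ibar ℙ η X S) = abar ℙ η X S ∧
    (∀ᵐ ω ∂ℙ, Ibar ℙ η X S (X ω) (S ω) ≤ max (S ω + abar ℙ η X S) 0) ∧
    ∀ a ∈ Icc (abar ℙ η X S) (piFull ℙ η X),
      ∀ I : ℝ → ℝ → ℝ, Adm M I → premium ℙ η X S I = a →
        u' (w - abar ℙ η X S) * (η / (1 + η)) * (a - abar ℙ η X S)
            ≤ EU ℙ η τ w X S u (Ibar ℙ η X S) - EU ℙ η τ w X S u I ∧
        0 ≤ u' (w - abar ℙ η X S) * (η / (1 + η)) * (a - abar ℙ η X S) := by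
  have hXM : ∀ᵐ ω ∂ℙ, X ω ≤ M := hM ▸ ae_le_of_essSup_pos (hM ▸ hM0)
  have hXi : Integrable X ℙ :=
    Integrable.of_mem_Icc 0 M hXm.aemeasurable (hXM.mono fun ω h => ⟨hX0 ω, h⟩)
  have hprem : premium ℙ η X S (Ibar ℙ η X S) = abar ℙ η X S :=
    sub_eq_zero.1 (gfun_abar_eq_zero ℙ hη hXm hSm hX0 hXi)
  have hanti : Antitone u' := antitone_of_hasDerivAt_nonpos hu'' fun x => (hu''neg x).le
  have hmono : Monotone u := monotone_of_hasDerivAt_nonneg hu' fun x => (hu'pos x).le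
  have hcont : Continuous u := continuous_iff_continuousAt.2 fun x => (hu' x).continuousAt
  refine ⟨hprem, Filter.Eventually.of_forall fun ω => ?_, ?_⟩
  · rw [Ibar, sub_max_sub_zero_eq_min]
    exact min_le_right _ _
  rintro a ⟨hba, -⟩ I ⟨hIm, hI⟩ hIa
  have hη1 : (0 : ℝ) < 1 + η := by linarith
  refine ⟨?_, mul_nonneg (mul_nonneg (hu'pos _).le (div_nonneg hη hη1.le)) (sub_nonneg.2 hba)⟩
  unfold EU wealth
  simp only [hprem, hIa]
  have hbarI : ∀ x s, Ibar ℙ η X S x s = min x (max (s + abar ℙ η X S) 0) := fun x s =>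
    sub_max_sub_zero_eq_min _ _
  unfold premium at hprem hIa
  simp only [hbarI] at hprem ⊢
  clear hbarI
  generalize abar ℙ η X S = b at *
  simp only [if_pos (min_le_right _ _)]
  have hImeas : Measurable fun ω => I (X ω) (S ω) := hIm.comp (hXm.prodMk hSm)
  have hIbd : ∀ᵐ ω ∂ℙ, I (X ω) (S ω) ∈ Icc 0 M := hXM.mono fun ω h =>
    ⟨(hI _ ⟨hX0 ω, h⟩ _).1, (hI _ ⟨hX0 ω, h⟩ _).2.trans h⟩
  have hIi : Integrable (fun ω => I (X ω) (S ω)) ℙ :=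
    Integrable.of_mem_Icc 0 M hImeas.aemeasurable hIbd
  have hbarmeas : Measurable fun ω => min (X ω) (max (S ω + b) 0) := by fun_prop
  have hbarbd : ∀ᵐ ω ∂ℙ, min (X ω) (max (S ω + b) 0) ∈ Icc 0 M := hXM.mono fun ω h =>
    ⟨le_min (hX0 ω) (le_max_right _ _), (min_le_left _ _).trans h⟩
  have hbari : Integrable (fun ω => min (X ω) (max (S ω + b) 0)) ℙ :=
    Integrable.of_mem_Icc 0 M hbarmeas.aemeasurable hbarbd
  have hubar : Integrable (fun ω => u (w - X ω - b + min (X ω) (max (S ω + b) 0))) ℙ := by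
    refine integrable_monotone_comp_of_ae_mem_Icc (l := w - M - b) (r := w - b + M) hcont hmono
      (by fun_prop) ?_
    filter_upwards [hXM, hbarbd] with ω hx hb
    exact ⟨by linarith [hb.1], by linarith [hb.2, hX0 ω]⟩
  have huI : Integrable (fun ω => u (w - X ω - a + if I (X ω) (S ω) ≤ max (S ω + a) 0
      then I (X ω) (S ω) else τ * max (S ω + a) 0)) ℙ := by
    refine integrable_monotone_comp_of_ae_mem_Icc (l := w - M - a) (r := w - a + M) hcont hmono
      (by
        refine Measurable.add (by fun_prop) (Measurable.ite ?_ hImeas (by fun_prop))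
        exact measurableSet_le hImeas (by fun_prop)) ?_
    filter_upwards [hXM, hIbd] with ω hx hi
    have hr : 0 ≤ max (S ω + a) 0 := le_max_right _ _
    have hlow := ite_payment_nonneg hτ.1 hr hi.1
    have hup := (ite_payment_le (i := I (X ω) (S ω)) hτ.2 hr).1
    exact ⟨by linarith, by linarith [hi.2, hX0 ω]⟩
  rw [← integral_sub hubar huI]
  have hsum : Integrable (fun ω => a - b + min (X ω) (max (S ω + b) 0)) ℙ :=
    (integrable_const _).add hbari
  calc u' (w - b) * (η / (1 + η)) * (a - b)
      = ∫ ω, u' (w - b) * (a - b + min (X ω) (max (S ω + b) 0) - I (X ω) (S ω)) ∂ℙ := by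
        rw [integral_const_mul, integral_sub hsum hIi,
          integral_add (integrable_const _) hbari, integral_const, probReal_univ, one_smul,
          eq_div_of_mul_eq hη1.ne' ((mul_comm _ _).trans hprem),
          eq_div_of_mul_eq hη1.ne' ((mul_comm _ _).trans hIa)]
        field_simp
        ring
    _ ≤ _ := by
        refine integral_mono ((hsum.sub hIi).const_mul _) (hubar.sub huI) fun ω => ?_
        have hq := ite_payment_le (i := I (X ω) (S ω)) hτ.2 (le_max_right (S ω + a) 0)
        exact utility_gap_ge hu' hanti hu'pos hba hq.1 hq.2
end
end

section
/- Suppose Assumption A holds and η ≥ u′(w − M)/𝔼[u′(w − X)] − 1. Then the zero contract is globally optimal: 𝔼[u(W(I))] ≤ 𝔼[u(w − X)] for every I ∈ 𝓐. -/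
open MeasureTheory Set

noncomputable section

variable {Ω : Type*} [MeasurableSpace Ω]

/-- Distribution function of a random variable. -/
def distFn (ℙ : Measure Ω) (Y : Ω → ℝ) (t : ℝ) : ℝ := (ℙ {ω | Y ω ≤ t}).toReal

/-- The set of discontinuity points in `[0, M]` of the distribution function of `Y`. -/
def JumpSet (ℙ : Measure Ω) (Y : Ω → ℝ) (M : ℝ) : Set ℝ :=
  {x ∈ Icc (0 : ℝ) M | ¬ ContinuousAt (distFn ℙ Y) x}

/-- Assumption A: (1) `S ≥ 0` a.s.; (2) the distribution functions of `X` and of `X − S`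
have finitely many discontinuity points in `[0, M]`; (3) the distribution function of `X`
is strictly increasing on `[0, M]`; (4) `𝔼[(X − y)⁺ − (X − y − S)⁺] > 0` for `y ∈ [0, M)`. -/
def AssumpA (ℙ : Measure Ω) (X S : Ω → ℝ) (M : ℝ) : Prop :=
  (∀ᵐ ω ∂ℙ, 0 ≤ S ω) ∧
  (JumpSet ℙ X M).Finite ∧
  (JumpSet ℙ (fun ω => X ω - S ω) M).Finite ∧
  StrictMonoOn (distFn ℙ X) (Icc 0 M) ∧
  ∀ y ∈ Ico (0 : ℝ) M, 0 < ∫ ω, (max (X ω - y) 0 - max (X ω - y - S ω) 0) ∂ℙ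

/-- `g_a(y) = (1+η)·𝔼[(X − y)⁺ − (X − y − (S+a))⁺] − a`. -/
def gA (ℙ : Measure Ω) (η : ℝ) (X S : Ω → ℝ) (a y : ℝ) : ℝ :=
  (1 + η) * ∫ ω, (max (X ω - y) 0 - max (X ω - y - (S ω + a)) 0) ∂ℙ - a

/-- The threshold `u′(w − M)/𝔼[u′(w − X)] − 1` for the premium loading. -/
def thr (ℙ : Measure Ω) (X : Ω → ℝ) (u' : ℝ → ℝ) (w M : ℝ) : ℝ :=
  u' (w - M) / (∫ ω, u' (w - X ω) ∂ℙ) - 1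

/-- A differentiable function with antitone derivative lies below its tangent lines. -/
theorem le_tangent_of_antitone_deriv {u u' : ℝ → ℝ} (hu' : ∀ x, HasDerivAt u (u' x) x)
    (hanti : Antitone u') (x y : ℝ) : u y ≤ u x + u' x * (y - x) := by
  rcases lt_trichotomy x y with h | rfl | h
  · obtain ⟨c, hc, e⟩ := exists_hasDerivAt_eq_slope u u' h
      (fun z _ => (hu' z).continuousAt.continuousWithinAt) (fun z _ => hu' z)
    rw [eq_div_iff (by linarith)] at e
    have := mul_le_mul_of_nonneg_right (hanti hc.1.le) (sub_nonneg.2 h.le)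
    linarith
  · simp
  · obtain ⟨c, hc, e⟩ := exists_hasDerivAt_eq_slope u u' h
      (fun z _ => (hu' z).continuousAt.continuousWithinAt) (fun z _ => hu' z)
    rw [eq_div_iff (by linarith)] at e
    have := mul_le_mul_of_nonneg_right (hanti hc.2.le) (sub_nonneg.2 h.le)
    linarith

/-- A real function whose essential supremum is nonzero is a.e. bounded by it. -/
theorem ae_le_essSup_of_ne_zero {Ω : Type*} [MeasurableSpace Ω] {μ : Measure Ω} {X : Ω → ℝ}
    (h : essSup X μ ≠ 0) : ∀ᵐ ω ∂μ, X ω ≤ essSup X μ := by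
  refine ae_le_essSup (f := X) (hf := ?_)
  by_contra hb
  apply h
  have hempty : {a : ℝ | ∀ᶠ ω in ae μ, X ω ≤ a} = ∅ :=
    eq_empty_of_forall_notMem fun a ha => hb ⟨a, ha⟩
  rw [essSup, Filter.limsup_eq, hempty, Real.sInf_empty]

/-- A continuous function of an a.e. bounded measurable function is integrable. -/
theorem Continuous.integrable_comp_of_ae_mem_Icc {Ω : Type*} [MeasurableSpace Ω] {μ : Measure Ω}
    [IsFiniteMeasure μ] {f : ℝ → ℝ} (hf : Continuous f) {Y : Ω → ℝ} (hY : Measurable Y) {a b : ℝ}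
    (hab : ∀ᵐ ω ∂μ, Y ω ∈ Icc a b) : Integrable (fun ω => f (Y ω)) μ := by
  obtain ⟨C, hC⟩ := isCompact_Icc.exists_bound_of_continuousOn (s := Icc a b) hf.continuousOn
  exact Integrable.of_bound (hf.measurable.comp hY).aestronglyMeasurable C
    (hab.mono fun ω hω => hC _ hω)

/-- under Assumption A, if `η ≥ u′(w−M)/𝔼[u′(w−X)] − 1`, then the zero
contract is globally optimal: `𝔼[u(W(I))] ≤ 𝔼[u(w − X)]` for every `I ∈ 𝓐`. -/
theorem stmt9
    (ℙ : Measure Ω) [IsProbabilityMeasure ℙ]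
    (X S : Ω → ℝ) (hXm : Measurable X) (hSm : Measurable S)
    (hX0 : ∀ ω, 0 ≤ X ω) (M : ℝ) (hM : essSup X ℙ = M) (hM0 : 0 < M)
    (η : ℝ) (hη : 0 ≤ η) (τ : ℝ) (hτ : τ ∈ Icc (0 : ℝ) 1) (w : ℝ)
    (u u' u'' : ℝ → ℝ)
    (hu' : ∀ x, HasDerivAt u (u' x) x) (hu'' : ∀ x, HasDerivAt u' (u'' x) x)
    (hu'pos : ∀ x, 0 < u' x) (hu''neg : ∀ x, u'' x < 0)
    (hA : AssumpA ℙ X S M)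
    (hη2 : thr ℙ X u' w M ≤ η) :
    ∀ I : ℝ → ℝ → ℝ, Adm M I →
      EU ℙ η τ w X S u I ≤ ∫ ω, u (w - X ω) ∂ℙ := by
  intro I hI
  obtain ⟨hIm, hIb⟩ := hI
  have hanti : Antitone u' :=
    antitone_of_hasDerivAt_nonpos hu'' fun x => (hu''neg x).le
  have huc : Continuous u := continuous_iff_continuousAt.2 fun x => (hu' x).continuousAt
  have hu'c : Continuous u' := continuous_iff_continuousAt.2 fun x => (hu'' x).continuousAt
  have hXM : ∀ᵐ ω ∂ℙ, X ω ≤ M := by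
    have := ae_le_essSup_of_ne_zero (X := X) (μ := ℙ) (by rw [hM]; exact hM0.ne')
    rwa [hM] at this
  set J : Ω → ℝ := fun ω => I (X ω) (S ω)
  set p := premium ℙ η X S I with hp
  have hJm : Measurable J := hIm.comp (hXm.prodMk hSm)
  have hJb : ∀ᵐ ω ∂ℙ, J ω ∈ Icc 0 M ∧ J ω ≤ X ω := by
    filter_upwards [hXM] with ω hω
    have := hIb (X ω) ⟨hX0 ω, hω⟩ (S ω)
    exact ⟨⟨this.1, this.2.trans hω⟩, this.2⟩
  have hJi : Integrable J ℙ :=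
    continuous_id.integrable_comp_of_ae_mem_Icc hJm (hJb.mono fun _ h => h.1)
  have hJ0 : 0 ≤ ∫ ω, J ω ∂ℙ := integral_nonneg_of_ae (hJb.mono fun _ h => h.1.1)
  have hwX : ∀ᵐ ω ∂ℙ, w - X ω ∈ Icc (w - M) w := by
    filter_upwards [hXM] with ω hω
    exact ⟨by linarith, by linarith [hX0 ω]⟩
  have hwXm : Measurable fun ω => w - X ω := measurable_const.sub hXm
  have hui := huc.integrable_comp_of_ae_mem_Icc hwXm hwX
  have hu'i := hu'c.integrable_comp_of_ae_mem_Icc hwXm hwX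
  have hWm : Measurable (wealth ℙ η τ w X S I) := by
    have hR : Measurable fun ω => max (S ω + p) 0 := (hSm.add_const p).max measurable_const
    exact (hwXm.sub_const p).add
      (Measurable.ite (measurableSet_le hJm hR) hJm (measurable_const.mul hR))
  have hWle : ∀ᵐ ω ∂ℙ, w - X ω - p ≤ wealth ℙ η τ w X S I ω ∧
      wealth ℙ η τ w X S I ω ≤ w - X ω - p + J ω := by
    filter_upwards [hJb] with ω hω
    have hR : 0 ≤ max (S ω + p) 0 := le_max_right _ _
    have h1 := mul_nonneg hτ.1 hR
    have h2 := mul_le_of_le_one_left hR hτ.2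
    have h3 := hω.1.1
    simp only [wealth, ← hp]
    change _ ≤ _ + (if J ω ≤ _ then J ω else _) ∧ _ + (if J ω ≤ _ then J ω else _) ≤ _
    split_ifs with h
    · exact ⟨by linarith, le_rfl⟩
    · rw [not_le] at h
      exact ⟨by linarith, by linarith⟩
  have hWi : Integrable (fun ω => u (wealth ℙ η τ w X S I ω)) ℙ := by
    refine huc.integrable_comp_of_ae_mem_Icc hWm (a := w - M - p) (b := w - p) ?_
    filter_upwards [hWle, hJb, hXM] with ω h1 h2 h3
    exact ⟨by linarith [h1.1], by linarith [h1.2, h2.2]⟩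
  have hpt : ∀ᵐ ω ∂ℙ, u (wealth ℙ η τ w X S I ω) ≤
      u (w - X ω) + (u' (w - M) * J ω - u' (w - X ω) * p) := by
    filter_upwards [hWle, hJb, hwX] with ω h1 h2 h3
    have ht := le_tangent_of_antitone_deriv hu' hanti (w - X ω) (wealth ℙ η τ w X S I ω)
    have hm := mul_le_mul_of_nonneg_left
      (show wealth ℙ η τ w X S I ω - (w - X ω) ≤ J ω - p by linarith [h1.2])
      (hu'pos (w - X ω)).le
    have hk := mul_le_mul_of_nonneg_right (hanti h3.1) h2.1.1
    linarith
  have hE : 0 < ∫ ω, u' (w - X ω) ∂ℙ := by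
    have := integral_mono_ae (integrable_const (u' w)) hu'i (hwX.mono fun ω h => hanti h.2)
    simp only [integral_const, probReal_univ, one_smul] at this
    exact (hu'pos w).trans_le this
  have hload : u' (w - M) ≤ (1 + η) * ∫ ω, u' (w - X ω) ∂ℙ := by
    rw [← div_le_iff₀ hE]
    unfold thr at hη2
    linarith
  have hdi : Integrable (fun ω => u' (w - M) * J ω - u' (w - X ω) * p) ℙ :=
    (hJi.const_mul _).sub (hu'i.mul_const p)
  have hint := (integral_mono_ae hWi (hui.add hdi) hpt).trans_eq (integral_add hui hdi)
  rw [integral_sub (hJi.const_mul _) (hu'i.mul_const p), integral_const_mul,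
    integral_mul_const] at hint
  have hpe : p = (1 + η) * ∫ ω, J ω ∂ℙ := rfl
  have hfin := mul_le_mul_of_nonneg_right hload hJ0
  have : (∫ ω, u' (w - X ω) ∂ℙ) * p =
      (1 + η) * (∫ ω, u' (w - X ω) ∂ℙ) * ∫ ω, J ω ∂ℙ := by rw [hpe]; ring
  unfold EU
  linarith
end
end
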